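/- arXiv:2401.11461 — 10 statements merged into one kernel-verified Lean document; each statement's English description precedes it below -/
import Mathlib

section
/- If R is a UWNC ring and S is a UNC ring, then the product ring R × S is a UWNC ring. -/
/-- An element is weakly nil-clean if it is `e + n` or `-e + n`
for an idempotent `e` and a nilpotent `n`. -/
def IsWeaklyNilClean {R : Type*} [Ring R] (a : R) : Prop :=
  ∃ e n : R, IsIdempotentElem e ∧ IsNilpotent n ∧ (a = e + n ∨ a = -e + n)

/-- An element is nil-clean if it is `e + n` for an idempotent `e` and a nilpotent `n`. -/
def IsNilClean {R : Type*} [Ring R] (a : R) : Prop :=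
  ∃ e n : R, IsIdempotentElem e ∧ IsNilpotent n ∧ a = e + n

/-- A ring is UWNC if every unit is weakly nil-clean. -/
def IsUWNC (R : Type*) [Ring R] : Prop :=
  ∀ u : Rˣ, IsWeaklyNilClean (u : R)

/-- A ring is UNC if every unit is nil-clean. -/
def IsUNC (R : Type*) [Ring R] : Prop :=
  ∀ u : Rˣ, IsNilClean (u : R)

theorem IsNilpotent.prodMk {R S : Type*} [MonoidWithZero R] [MonoidWithZero S] {a : R} {b : S}
    (ha : IsNilpotent a) (hb : IsNilpotent b) : IsNilpotent (a, b) := by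
  obtain ⟨k, hk⟩ := ha
  obtain ⟨l, hl⟩ := hb
  exact ⟨k + l, Prod.ext (pow_eq_zero_of_le (Nat.le_add_right k l) hk)
    (pow_eq_zero_of_le (Nat.le_add_left l k) hl)⟩

theorem prod_isUWNC_of_isUWNC_of_isUNC {R S : Type*} [Ring R] [Ring S]
    (hR : IsUWNC R) (hS : IsUNC S) : IsUWNC (R × S) := by
  intro u
  obtain ⟨e, n, he, hn, h | h⟩ := hR (MulEquiv.prodUnits u).1
  · obtain ⟨f, m, hf, hm, h'⟩ := hS (MulEquiv.prodUnits u).2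
    exact ⟨(e, f), (n, m), Prod.ext he hf, hn.prodMk hm, Or.inl (Prod.ext h h')⟩
  · obtain ⟨f, m, hf, hm, h'⟩ := hS (-(MulEquiv.prodUnits u).2)
    have h_neg : ((MulEquiv.prodUnits u).2 : S) = -f + -m := by
      rw [← neg_add, ← h', Units.val_neg, neg_neg]
    exact ⟨(e, f), (n, -m), Prod.ext he hf, hn.prodMk hm.neg, Or.inr (Prod.ext h h_neg)⟩
end

section
/- For any ring R and any integer n ≥ 2, the direct power ring R^n (the product of n copies of R) is a UWNC ring if and only if R^n is a UNC ring, if and only if R is a UNC ring. -/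
/-- A ring is *WUU* if every unit is of the form `n + 1` or `n - 1`
for a nilpotent `n`. -/
def IsWUU (R : Type*) [Ring R] : Prop :=
  ∀ u : Rˣ, ∃ n : R, IsNilpotent n ∧ ((u : R) = n + 1 ∨ (u : R) = n - 1)

theorem IsNilClean.of_apply {ι : Type*} [Finite ι] {R : ι → Type*} [∀ i, Ring (R i)]
    {a : ∀ i, R i} (h : ∀ i, IsNilClean (a i)) : IsNilClean a := by
  have := Fintype.ofFinite ι
  choose e b he hb hab using h
  choose k hk using hb
  refine ⟨e, b, funext he, ⟨∑ i, k i, funext fun i => ?_⟩, funext hab⟩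
  exact pow_eq_zero_of_le (Finset.single_le_sum (fun _ _ => Nat.zero_le _) (Finset.mem_univ i))
    (hk i)

theorem IsUNC.isUWNC {R : Type*} [Ring R] (h : IsUNC R) : IsUWNC R := fun u =>
  let ⟨e, b, he, hb, hu⟩ := h u
  ⟨e, b, he, hb, Or.inl hu⟩

theorem IsUNC.pi {ι : Type*} [Finite ι] {R : ι → Type*} [∀ i, Ring (R i)]
    (h : ∀ i, IsUNC (R i)) : IsUNC (∀ i, R i) := fun u =>
  IsNilClean.of_apply fun i => h i (MulEquiv.piUnits u i)

theorem IsIdempotentElem.apply {ι : Type*} {R : ι → Type*} [∀ i, Mul (R i)] {e : ∀ i, R i}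
    (he : IsIdempotentElem e) (i : ι) : IsIdempotentElem (e i) :=
  congrFun he i

/-- If a nontrivial power of `R` is UWNC, then `R` is UNC: apply the hypothesis to the unit with
one coordinate `u` and all the others `-u`. -/
theorem IsUNC.of_isUWNC_pi {ι : Type*} [Nontrivial ι] {R : Type*} [Ring R]
    (h : IsUWNC (ι → R)) : IsUNC R := by
  classical
  intro u
  obtain ⟨i, j, hij⟩ := exists_pair_ne ι
  obtain ⟨e, b, he, hb, hu | hu⟩ :=
    h (MulEquiv.piUnits.symm fun k => if k = i then u else -u)
  · exact ⟨e i, b i, he.apply i, hb.map (Pi.evalRingHom (fun _ => R) i), by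
      simpa using congrFun hu i⟩
  · refine ⟨e j, -b j, he.apply j, (hb.map (Pi.evalRingHom (fun _ => R) j)).neg, ?_⟩
    have hj : -(u : R) = -e j + b j := by simpa [hij.symm] using congrFun hu j
    rw [← neg_neg (u : R), hj, neg_add, neg_neg]

theorem pow_isUWNC_iff_isUNC {R : Type*} [Ring R] (n : ℕ) (hn : 2 ≤ n) :
    (IsUWNC (Fin n → R) ↔ IsUNC (Fin n → R)) ∧ (IsUNC (Fin n → R) ↔ IsUNC R) := by
  have : Nontrivial (Fin n) := Fin.nontrivial_iff_two_le.mpr hn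
  exact ⟨⟨fun h => IsUNC.pi fun _ => IsUNC.of_isUWNC_pi h, IsUNC.isUWNC⟩,
    ⟨fun h => IsUNC.of_isUWNC_pi h.isUWNC, fun h => IsUNC.pi fun _ => h⟩⟩
end

section
/- Let R be a UWNC ring and let f : R → T be a surjective ring homomorphism such that every unit of T lifts to a unit of R (i.e., for every unit v of T there exists a unit u of R with f(u) = v). Then T is a UWNC ring. -/
theorem IsWeaklyNilClean.map {R T : Type*} [Ring R] [Ring T] (f : R →+* T) {a : R}
    (ha : IsWeaklyNilClean a) : IsWeaklyNilClean (f a) := by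
  obtain ⟨e, n, he, hn, h⟩ := ha
  refine ⟨f e, f n, he.map f, hn.map f, ?_⟩
  rcases h with rfl | rfl <;> simp

theorem isUWNC_of_surjective_units_lift {R T : Type*} [Ring R] [Ring T]
    (hR : IsUWNC R) (f : R →+* T) (hf : Function.Surjective f)
    (hlift : ∀ v : Tˣ, ∃ u : Rˣ, f (u : R) = (v : T)) :
    IsUWNC T := by
  intro v
  obtain ⟨u, hu⟩ := hlift v
  exact hu ▸ (hR u).map f
end

section
/- Let R be a ring and M an (R,R)-bimodule. The trivial extension T(R,M) = R ⊕ M, with multiplication (r₁, m₁)(r₂, m₂) = (r₁r₂, r₁m₂ + m₁r₂), is a UWNC ring if and only if R is a UWNC ring. -/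
section TrivSqZeroExt

variable {R M : Type*} [Ring R] [AddCommGroup M] [Module R M] [Module Rᵐᵒᵖ M]
  [SMulCommClass R Rᵐᵒᵖ M]

theorem TrivSqZeroExt.isWeaklyNilClean_iff_fst {x : TrivSqZeroExt R M} :
    IsWeaklyNilClean x ↔ IsWeaklyNilClean x.fst := by
  constructor
  · rintro ⟨e, n, he, hn, h⟩
    refine ⟨e.fst, n.fst, ?_, TrivSqZeroExt.isNilpotent_iff_isNilpotent_fst.mp hn, ?_⟩
    · rw [IsIdempotentElem, ← TrivSqZeroExt.fst_mul, he.eq]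
    · rcases h with rfl | rfl
      · exact Or.inl rfl
      · exact Or.inr rfl
  · rintro ⟨e, n, he, hn, h⟩
    refine ⟨TrivSqZeroExt.inl e, TrivSqZeroExt.inl n + TrivSqZeroExt.inr x.snd, ?_, ?_, ?_⟩
    · rw [IsIdempotentElem, TrivSqZeroExt.inl_mul_inl, he.eq]
    · rw [TrivSqZeroExt.isNilpotent_iff_isNilpotent_fst]
      simpa using hn
    · refine h.imp (fun h => ?_) (fun h => ?_) <;> ext <;> simp [h]

end TrivSqZeroExt

theorem trivSqZeroExt_isUWNC_iff {R M : Type*} [Ring R] [AddCommGroup M]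
    [Module R M] [Module Rᵐᵒᵖ M] [SMulCommClass R Rᵐᵒᵖ M] :
    IsUWNC (TrivSqZeroExt R M) ↔ IsUWNC R := by
  constructor
  · intro h u
    have hu : IsUnit (TrivSqZeroExt.inl (u : R) : TrivSqZeroExt R M) :=
      TrivSqZeroExt.isUnit_inl_iff.mpr u.isUnit
    simpa using TrivSqZeroExt.isWeaklyNilClean_iff_fst.mp (h hu.unit)
  · intro h u
    exact TrivSqZeroExt.isWeaklyNilClean_iff_fst.mpr
      (h (TrivSqZeroExt.isUnit_iff_isUnit_fst.mp u.isUnit).unit)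
end

section
/- If R is a UWNC ring, then the center Z(R) of R is a WUU ring. -/
/-- An idempotent that differs from a unit by a nilpotent commuting with that unit is `1`. -/
theorem IsIdempotentElem.eq_one_of_isUnit_add {R : Type*} [Ring R] {e n : R}
    (he : IsIdempotentElem e) (hn : IsNilpotent n) (hu : IsUnit (e + n)) (hc : Commute n (e + n)) :
    e = 1 := by
  have hunit : IsUnit e := by
    simpa using hn.neg.isUnit_add_left_of_commute hu hc.neg_left
  exact (IsIdempotentElem.iff_eq_one_of_isUnit hunit).mp he

theorem center_isWUU_of_isUWNC {R : Type*} [Ring R] (h : IsUWNC R) :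
    IsWUU (Subring.center R) := by
  intro u
  have hc (x : R) : Commute x (u : Subring.center R) :=
    Subring.mem_center_iff.mp (u : Subring.center R).2 x
  have hu : IsUnit ((u : Subring.center R) : R) := u.isUnit.map (Subring.center R).subtype
  have hnil (x : Subring.center R) (hx : IsNilpotent (x : R)) : IsNilpotent x :=
    (IsNilpotent.map_iff (f := (Subring.center R).subtype) Subtype.val_injective).mp hx
  obtain ⟨e, n, he, hn, h | h⟩ := h (Units.map (Subring.center R).subtype.toMonoidHom u)
  · change ((u : Subring.center R) : R) = e + n at h
    obtain rfl := he.eq_one_of_isUnit_add hn (h ▸ hu) (h ▸ hc n)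
    exact ⟨u - 1, hnil _ (by simpa [h] using hn), .inl (by simp)⟩
  · change ((u : Subring.center R) : R) = -e + n at h
    have h' : -((u : Subring.center R) : R) = e + -n := by rw [h]; abel
    obtain rfl := he.eq_one_of_isUnit_add hn.neg (h' ▸ hu.neg) (h' ▸ (hc (-n)).neg_right)
    exact ⟨u + 1, hnil _ (by simpa [h] using hn), .inr (by simp)⟩
end

section
/- Let R be a ring. Then R is a UNC ring if and only if R is a UWNC ring and 2 belongs to the Jacobson radical J(R). -/
/-- A unit which is the sum of an idempotent and a nilpotent commuting with it is unipotent. -/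
theorem IsUnit.isNilpotent_sub_one_of_eq_add {R : Type*} [Ring R] {u e n : R} (hu : IsUnit u)
    (he : IsIdempotentElem e) (hn : IsNilpotent n) (hc : Commute n u) (h : u = e + n) :
    IsNilpotent (u - 1) := by
  have hsub : e = u + -n := by rw [h, add_neg_cancel_right]
  have heu : IsUnit e := hsub ▸ hn.neg.isUnit_add_left_of_commute hu hc.neg_left
  have he1 : e = 1 := (IsIdempotentElem.iff_eq_one_of_isUnit heu).mp he
  rwa [h, he1, add_sub_cancel_left]

/-- Adding a multiple of a central nilpotent element preserves nilpotency. -/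
theorem IsNilpotent.add_mul_of_central {R : Type*} [Ring R] {n c : R} (hn : IsNilpotent n)
    (hc : IsNilpotent c) (hcomm : ∀ x, Commute c x) (a : R) : IsNilpotent (n + c * a) := by
  have key (k : ℕ) : ∃ r, (n + c * a) ^ k = n ^ k + c * r := by
    induction k with
    | zero => exact ⟨0, by simp⟩
    | succ k ih =>
      obtain ⟨r, hr⟩ := ih
      refine ⟨n ^ k * a + r * (n + c * a), ?_⟩
      rw [_root_.pow_succ, hr, _root_.pow_succ, add_mul, mul_add, mul_add, ← mul_assoc (n ^ k) c a,
        ← (hcomm (n ^ k)).eq]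
      simp only [mul_add, mul_assoc, add_assoc]
  obtain ⟨k, hk⟩ := hn
  obtain ⟨r, hr⟩ := key k
  rw [hk, zero_add] at hr
  exact .of_pow (hr ▸ (hcomm r).isNilpotent_mul_right hc : IsNilpotent ((n + c * a) ^ k))

theorem IsNilpotent.mem_jacobson_bot_of_central {R : Type*} [Ring R] {c : R}
    (hc : IsNilpotent c) (hcomm : ∀ x, Commute c x) :
    c ∈ (⊥ : TwoSidedIdeal R).jacobson := by
  refine TwoSidedIdeal.mem_jacobson_iff.mpr fun y => ?_
  obtain ⟨z, hz⟩ := ((hcomm y).symm.isNilpotent_mul_left hc).isUnit_add_one.exists_left_inv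
  exact ⟨z, by rw [mul_assoc, ← mul_add_one, hz, sub_self]; exact zero_mem _⟩

theorem IsNilClean.isWeaklyNilClean {R : Type*} [Ring R] {a : R} (h : IsNilClean a) :
    IsWeaklyNilClean a :=
  let ⟨e, n, he, hn, ha⟩ := h
  ⟨e, n, he, hn, .inl ha⟩

theorem IsUNC.isNilpotent_two {R : Type*} [Ring R] (h : IsUNC R) : IsNilpotent (2 : R) := by
  obtain ⟨e, n, he, hn, hu⟩ := h (-1)
  have := (-1 : Rˣ).isUnit.isNilpotent_sub_one_of_eq_add he hn (by simp) hu
  rw [← isNilpotent_neg_iff] at this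
  norm_num at this
  exact this

theorem isUnit_three_of_two_mem_jacobson_bot {R : Type*} [Ring R]
    (h : (2 : R) ∈ (⊥ : TwoSidedIdeal R).jacobson) : IsUnit (3 : R) := by
  obtain ⟨z, hz⟩ := TwoSidedIdeal.mem_jacobson_iff.mp h 1
  have hz3 : z * 3 = 1 := by
    rw [TwoSidedIdeal.mem_bot, mul_one, sub_eq_zero, ← mul_add_one] at hz
    norm_num at hz
    exact hz
  exact ⟨⟨3, z, (Nat.cast_commute 3 z).eq.trans hz3, hz3⟩, rfl⟩

theorem IsUWNC.isNilpotent_two {R : Type*} [Ring R] (h : IsUWNC R)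
    (h2 : (2 : R) ∈ (⊥ : TwoSidedIdeal R).jacobson) : IsNilpotent (2 : R) := by
  have h3 := isUnit_three_of_two_mem_jacobson_bot h2
  have hcomm (x : R) : Commute x 3 := (Nat.cast_commute 3 x).symm
  obtain ⟨e, n, he, hn, hu | hu⟩ := h h3.unit <;> rw [IsUnit.unit_spec] at hu
  · have := h3.isNilpotent_sub_one_of_eq_add he hn (hcomm n) hu
    norm_num at this
    exact this
  · have := h3.neg.isNilpotent_sub_one_of_eq_add he hn.neg (hcomm _).neg_right
      (by rw [hu, neg_add, neg_neg])
    rw [← isNilpotent_neg_iff] at this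
    refine .of_pow (?_ : IsNilpotent ((2 : R) ^ 2))
    norm_num at this ⊢
    exact this

theorem isUNC_iff_isUWNC_and_two_mem_jacobson {R : Type*} [Ring R] :
    IsUNC R ↔ IsUWNC R ∧ (2 : R) ∈ (⊥ : TwoSidedIdeal R).jacobson := by
  refine ⟨fun h => ⟨fun u => (h u).isWeaklyNilClean,
    h.isNilpotent_two.mem_jacobson_bot_of_central (Nat.cast_commute 2)⟩, fun ⟨h, h2⟩ u => ?_⟩
  obtain ⟨e, n, he, hn, hu | hu⟩ := h u
  · exact ⟨e, n, he, hn, hu⟩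
  · refine ⟨e, n + 2 * -e, he,
      hn.add_mul_of_central (h.isNilpotent_two h2) (Nat.cast_commute 2) _, ?_⟩
    rw [hu]
    noncomm_ring
end

section
/- Let R be a ring and let r ∈ R be an element that can be written as r = e + n with e an idempotent and n a nilpotent of R (e and n need not commute). If r² = 1, then r is unipotent, i.e., r - 1 is nilpotent. -/
theorem isNilpotent_sub_one_of_sq_eq_one {R : Type*} [Ring R] {r e n : R}
    (he : IsIdempotentElem e) (hn : IsNilpotent n) (hr : r = e + n)
    (h2 : r ^ 2 = 1) : IsNilpotent (r - 1) := by
  have hee : e * e = e := he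
  have hrr : r * r = 1 := by rw [← sq, h2]
  obtain rfl : n = r - e := by rw [hr, add_sub_cancel_left]
  set n := r - e with hdef
  obtain ⟨u, hu⟩ := hn.isUnit_one_add
  have hc : n * (1 + n) = 1 + r - e * r - r * e := by
    simp only [hdef, mul_add, mul_sub, sub_mul, mul_one, hee, hrr]
    abel
  have hee' (x : R) : e * (e * x) = e * x := by rw [← mul_assoc, hee]
  have hrr' (x : R) : r * (r * x) = x := by rw [← mul_assoc, hrr, one_mul]
  have hcr : Commute (n * (1 + n)) r := by
    rw [hc]
    simp only [Commute, SemiconjBy, mul_add, mul_sub, sub_mul, add_mul, mul_one, one_mul,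
      mul_assoc, hrr, hrr']
    abel
  have hce : Commute (n * (1 + n)) e := by
    rw [hc]
    simp only [Commute, SemiconjBy, mul_add, mul_sub, sub_mul, add_mul, mul_one, one_mul,
      mul_assoc, hee, hee']
    abel
  have hcu : Commute (n * (1 + n)) ↑u⁻¹ := by
    refine Commute.units_inv_right ?_
    rw [hu]
    exact (Commute.one_right _).add_right (hcr.sub_right hce)
  have hcn : n = n * (1 + n) * ↑u⁻¹ := by rw [← hu, Units.mul_inv_cancel_right]
  have hnil : IsNilpotent (n * (1 + n)) :=
    ((Commute.one_right n).add_right (Commute.refl n)).isNilpotent_mul_right hn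
  have hone : r - 1 = n - (1 - e) * n * r := by
    simp only [hdef, mul_sub, sub_mul, one_mul, mul_one, mul_assoc, hee, hrr]
    abel
  have hfactor : r - 1 = n * (1 + n) * (↑u⁻¹ - (1 - e) * ↑u⁻¹ * r) := by
    have h1e : (1 - e) * (n * (1 + n)) = n * (1 + n) * (1 - e) :=
      (((Commute.one_right _).sub_right hce).eq).symm
    rw [hone]
    calc n - (1 - e) * n * r
        = n * (1 + n) * ↑u⁻¹ - (1 - e) * (n * (1 + n) * ↑u⁻¹) * r := by rw [← hcn]
      _ = _ := by
        rw [← mul_assoc (1 - e), h1e]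
        simp only [mul_sub, mul_assoc, sub_mul, mul_one, one_mul]
  rw [hfactor]
  exact (hcu.sub_right ((((Commute.one_right _).sub_right hce).mul_right hcu).mul_right
    hcr)).isNilpotent_mul_right hnil
end

section
/- Let R be a ring in which 2 is invertible. Then R is a UWNC ring if and only if R is a WUU ring. -/
theorem IsNilpotent.eq_zero_of_eq_mul_mul {R : Type*} [Ring R] {c p z : R}
    (hc : IsNilpotent c) (h : p = c * p * z) : p = 0 := by
  obtain ⟨k, hk⟩ := hc
  have key : ∀ m : ℕ, p = c ^ m * p * z ^ m := by
    intro m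
    induction m with
    | zero => simp
    | succ m ih =>
      calc p = c ^ m * p * z ^ m := ih
        _ = c ^ m * (c * p * z) * z ^ m := by rw [← h]
        _ = c ^ (m + 1) * p * z ^ (m + 1) := by rw [_root_.pow_succ c, _root_.pow_succ' z]; noncomm_ring
  rw [key k, hk, zero_mul, zero_mul]

/-- If `2` is invertible and `p + q` is nilpotent, with `p` and `q` idempotent, then `p = 0`:
the element `(p - q) ^ 2` is a nilpotent multiple of `p + q` that commutes with `p`. -/
theorem IsIdempotentElem.eq_zero_of_isNilpotent_add {R : Type*} [Ring R] (h2 : IsUnit (2 : R))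
    {p q : R} (hp : IsIdempotentElem p) (hq : IsIdempotentElem q) (hs : IsNilpotent (p + q)) :
    p = 0 := by
  have hpp : p * p = p := hp
  have hqq : q * q = q := hq
  have hpp' (x : R) : p * (p * x) = p * x := by rw [← mul_assoc, hpp]
  have hunit : IsUnit (2 - (p + q)) := by
    rw [sub_eq_add_neg]
    exact hs.neg.isUnit_add_left_of_commute h2 (Nat.cast_commute 2 _).symm
  obtain ⟨w, hw⟩ := hunit.exists_right_inv
  obtain ⟨t, ht⟩ := h2.exists_right_inv
  set c := (p + q) * (2 - (p + q)) with hcdef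
  have hc : IsNilpotent c :=
    ((Nat.cast_commute 2 (p + q)).symm.sub_right (Commute.refl _)).isNilpotent_mul_right hs
  have hc' : c = p + q - p * q - q * p := by
    rw [hcdef]
    simp only [mul_sub, mul_add, add_mul, hpp, hqq, mul_two]
    abel
  have hcp : c * p = p - p * q * p := by
    rw [hc']
    simp only [sub_mul, add_mul, mul_assoc, hpp]
    abel
  have hpc : p * c = p - p * q * p := by
    rw [hc']
    simp only [mul_sub, mul_add, mul_assoc, hpp, hpp']
    abel
  have hsw : p + q = c * w := by rw [hcdef, mul_assoc, hw, mul_one]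
  have h2p : p * 2 = c * p * (w * p + 1) := by
    calc p * 2 = p * (p + q) * p + c * p := by
          rw [hcp]
          simp only [mul_add, add_mul, mul_assoc, hpp, mul_two]
          abel
      _ = p * c * (w * p) + c * p := by rw [hsw]; noncomm_ring
      _ = c * p * (w * p + 1) := by rw [hpc, ← hcp]; noncomm_ring
  refine hc.eq_zero_of_eq_mul_mul (z := (w * p + 1) * t) ?_
  rw [← mul_assoc, ← h2p, mul_assoc, ht, mul_one]

theorem IsUWNC.isNilpotent_three {R : Type*} [Ring R] (h2 : IsUnit (2 : R)) (h : IsUWNC R) :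
    IsNilpotent (3 : R) := by
  obtain ⟨f, n, hf, hn, h' | h'⟩ := h h2.unit
  · rw [IsUnit.unit_spec] at h'
    have h1 : (1 : R) = 0 := by
      refine IsIdempotentElem.one.eq_zero_of_isNilpotent_add h2 hf.one_sub ?_
      convert hn using 1
      rw [eq_sub_of_add_eq' h'.symm, ← one_add_one_eq_two]
      abel
    have := subsingleton_of_zero_eq_one h1.symm
    exact ⟨1, Subsingleton.elim _ _⟩
  · rw [IsUnit.unit_spec] at h'
    have hff : f * f = f := hf
    have hfn : f = n - 2 := by rw [h']; abel
    have h6 : (2 : R) * 3 = n * (5 - n) := by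
      rw [hfn] at hff
      have : (2 : R) * 3 - n * (5 - n) = (n - 2) * (n - 2) - (n - 2) := by
        have h23 : (2 : R) * 3 = 2 * 2 + 2 := by norm_num
        rw [h23]
        noncomm_ring
      rwa [hff, sub_self, sub_eq_zero] at this
    have hnil : IsNilpotent ((2 : R) * 3) := by
      rw [h6]
      exact ((Nat.cast_commute 5 n).symm.sub_right (Commute.refl _)).isNilpotent_mul_right hn
    obtain ⟨t, ht⟩ := h2.exists_left_inv
    have h3 : (3 : R) = (2 * 3) * t := by
      have hc : Commute (3 : R) t := Nat.cast_commute 3 t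
      have hc2 : Commute (2 : R) t := Nat.cast_commute 2 t
      rw [mul_assoc, hc.eq, ← mul_assoc, hc2.eq, ht, one_mul]
    rw [h3]
    refine Commute.isNilpotent_mul_right ?_ hnil
    exact (Nat.cast_commute 2 t : Commute (2 : R) t).mul_left (Nat.cast_commute 3 t)

theorem IsUWNC.eq_zero_or_one_of_isIdempotentElem {R : Type*} [Ring R] (h2 : IsUnit (2 : R))
    (h : IsUWNC R) {e : R} (he : IsIdempotentElem e) : e = 0 ∨ e = 1 := by
  have hee : e * e = e := he
  obtain ⟨t, ht⟩ := h2.exists_left_inv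
  have htt : t + t = 1 := by rw [← mul_two, ht]
  have hte : t * e = e * t := by
    have hl : t * e * 2 = e := by
      rw [mul_assoc, ← show 2 * e = e * 2 from Nat.cast_commute 2 e, ← mul_assoc, ht, one_mul]
    have hr : e * t * 2 = e := by rw [mul_assoc, ht, mul_one]
    exact h2.mul_right_cancel (hl.trans hr.symm)
  have hte2 : t * e + t * e = e := by rw [← add_mul, htt, one_mul]
  have h1 : (1 + e) * (1 - t * e) = 1 := by
    have : e * (t * e) = t * e := by rw [← mul_assoc, ← hte, mul_assoc, hee]
    calc (1 + e) * (1 - t * e) = 1 + e - (t * e + e * (t * e)) := by noncomm_ring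
      _ = 1 := by rw [this, hte2]; abel
  have h1' : (1 - t * e) * (1 + e) = 1 := by
    calc (1 - t * e) * (1 + e) = 1 + e - (t * e + t * (e * e)) := by noncomm_ring
      _ = 1 := by rw [hee, hte2]; abel
  obtain ⟨f, n, hf, hn, h' | h'⟩ := h ⟨1 + e, 1 - t * e, h1, h1'⟩
  · left
    refine he.eq_zero_of_isNilpotent_add h2 hf.one_sub ?_
    convert hn using 1
    rw [eq_sub_of_add_eq' h'.symm]
    dsimp only
    abel
  · right
    have : 1 - e = 0 := by
      refine he.one_sub.eq_zero_of_isNilpotent_add h2 hf.one_sub ?_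
      have h3 := h.isNilpotent_three h2
      have hsum : 1 - e + (1 - f) = 3 - n := by
        have hn' : n = 1 + e + f := by
          rw [show 1 + e = -f + n from h']
          abel
        rw [hn', ← two_add_one_eq_three, ← one_add_one_eq_two]
        abel
      rw [hsum]
      exact (Nat.cast_commute 3 n : Commute (3 : R) n).isNilpotent_sub h3 hn
    exact (sub_eq_zero.mp this).symm

theorem isUWNC_iff_isWUU_of_two_isUnit {R : Type*} [Ring R] (h2 : IsUnit (2 : R)) :
    IsUWNC R ↔ IsWUU R := by
  constructor
  · intro h u
    obtain ⟨e, n, he, hn, hu⟩ := h u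
    rcases h.eq_zero_or_one_of_isIdempotentElem h2 he with rfl | rfl
    · have hun : (u : R) = n := by simpa using hu
      have : Subsingleton R := by
        obtain ⟨k, hk⟩ := hn
        rw [← hun] at hk
        exact subsingleton_of_zero_eq_one (isUnit_zero_iff.mp (hk ▸ u.isUnit.pow k))
      exact ⟨0, IsNilpotent.zero, Or.inl (Subsingleton.elim _ _)⟩
    · refine ⟨n, hn, hu.imp (fun h => ?_) fun h => ?_⟩
      · rw [h, add_comm]
      · rw [h, neg_add_eq_sub]
  · intro h u
    obtain ⟨n, hn, hu⟩ := h u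
    refine ⟨1, n, IsIdempotentElem.one, hn, hu.imp (fun h => ?_) fun h => ?_⟩
    · rw [h, add_comm]
    · rw [h, neg_add_eq_sub]
end

section
/- Let R be an abelian ring, i.e., every idempotent of R is central. Then R is a UWNC ring if and only if R is a WUU ring. -/
/-- If a unit is the sum of a central idempotent and a nilpotent element,
then the idempotent is `1`. -/
theorem IsIdempotentElem.eq_one_of_isUnit_add_isNilpotent {R : Type*} [Ring R] {e n : R}
    (he : IsIdempotentElem e) (hc : e ∈ Subring.center R) (hn : IsNilpotent n)
    (hu : IsUnit (e + n)) : e = 1 := by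
  have hcomm : Commute (-n) (e + n) :=
    (Commute.add_right (Subring.mem_center_iff.mp hc n) (Commute.refl n)).neg_left
  have hunit : IsUnit e := by
    simpa using hn.neg.isUnit_add_left_of_commute hu hcomm
  exact (IsIdempotentElem.iff_eq_one_of_isUnit hunit).mp he

theorem isUWNC_iff_isWUU_of_abelian {R : Type*} [Ring R]
    (h : ∀ e : R, IsIdempotentElem e → e ∈ Subring.center R) :
    IsUWNC R ↔ IsWUU R := by
  constructor
  · intro hR u
    obtain ⟨e, n, he, hn, hu | hu⟩ := hR u
    · have h1 : e = 1 :=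
        he.eq_one_of_isUnit_add_isNilpotent (h e he) hn (hu ▸ u.isUnit)
      exact ⟨n, hn, Or.inl (by rw [hu, h1, add_comm])⟩
    · have hneg : IsUnit (e + -n) := by
        have : e + -n = -(u : R) := by rw [hu]; abel
        exact this ▸ u.isUnit.neg
      have h1 : e = 1 := he.eq_one_of_isUnit_add_isNilpotent (h e he) hn.neg hneg
      exact ⟨n, hn, Or.inr (by rw [hu, h1]; abel)⟩
  · intro hR u
    obtain ⟨n, hn, hu | hu⟩ := hR u
    · exact ⟨1, n, IsIdempotentElem.one, hn, Or.inl (by rw [hu, add_comm])⟩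
    · exact ⟨1, n, IsIdempotentElem.one, hn, Or.inr (by rw [hu]; abel)⟩
end

section
/- Let p be a prime, let R be a UWNC ring in which the element p·1 is nilpotent, and let G be a locally finite p-group (every finitely generated subgroup of G is finite and the order of every element of G is a power of p). Then the group ring RG is a UWNC ring. -/
/-- If a prime `p` is nilpotent in a ring, then `z - 1` is nilpotent
for every `z` of `p`-power order. -/
theorem isNilpotent_sub_one_of_pow_prime_pow_eq_one {A : Type*} [Ring A] {p : ℕ} (hp : p.Prime)
    (hpA : IsNilpotent (p : A)) {z : A} {n : ℕ} (hz : z ^ p ^ n = 1) : IsNilpotent (z - 1) := by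
  obtain ⟨r, hr⟩ := (Commute.one_right (z - 1)).exists_add_pow_prime_pow_eq hp n
  rw [sub_add_cancel, hz, one_pow, mul_one] at hr
  have key : (z - 1) ^ p ^ n = (p : A) * -((z - 1) * r) := by
    linear_combination (norm := noncomm_ring) -hr
  refine IsNilpotent.of_pow (m := p ^ n) ?_
  rw [key]
  exact (Nat.cast_commute p _).isNilpotent_mul_right hpA

namespace MonoidAlgebra

variable {R G H : Type*} [Ring R] [Group G] [Group H]

variable (R G) in
/-- The augmentation homomorphism, sending `∑ r_g g` to `∑ r_g`. -/
noncomputable def augmentation : MonoidAlgebra R G →+* R :=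
  liftNCRingHom (RingHom.id R) 1 fun _ _ => Commute.one_right _

@[simp]
theorem augmentation_single (g : G) (r : R) : augmentation R G (single g r) = r := by
  simp [augmentation]

@[simp]
theorem augmentation_mapDomainRingHom (f : G →* H) (x : MonoidAlgebra R G) :
    augmentation R H (mapDomainRingHom R f x) = augmentation R G x := by
  induction x using induction_linear with
  | zero => simp
  | add x y hx hy => simp only [map_add, hx, hy]
  | single g r => simp

/-- Elements of the kernel of `R[G] → R[G ⧸ ⟨z⟩]` are multiples of `z - 1`. -/
theorem exists_eq_mul_of_mapDomain_mk_eq_zero [Finite G] {z : G} (hz : z ∈ Subgroup.center G)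
    {x : MonoidAlgebra R G}
    (hx : mapDomain (QuotientGroup.mk : G → G ⧸ Subgroup.zpowers z) x = 0) :
    ∃ y, x = (single z 1 - 1) * y := by
  have key : ∀ x : MonoidAlgebra R G, ∃ y, x - mapDomain Quotient.out
      (mapDomain (QuotientGroup.mk : G → G ⧸ Subgroup.zpowers z) x) = (single z 1 - 1) * y := by
    intro x
    induction x using induction_linear with
    | zero => exact ⟨0, by simp⟩
    | add a b ha hb =>
      obtain ⟨y, hy⟩ := ha
      obtain ⟨w, hw⟩ := hb
      refine ⟨y + w, ?_⟩
      rw [mul_add, ← hy, ← hw, mapDomain_add, mapDomain_add]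
      abel
    | single g r =>
      simp only [mapDomain_single]
      set s : G := Quotient.out (g : G ⧸ Subgroup.zpowers z) with hs
      have hmem : s⁻¹ * g ∈ Subgroup.zpowers z :=
        QuotientGroup.eq.1 (Quotient.out_eq (g : G ⧸ Subgroup.zpowers z))
      obtain ⟨k, hk⟩ := mem_powers_iff_mem_zpowers.2 hmem
      have hg : g = z ^ k * s := by
        rw [← (Subgroup.mem_center_iff.1 (pow_mem hz k) s), show z ^ k = s⁻¹ * g from hk,
          mul_inv_cancel_left]
      refine ⟨(∑ i ∈ Finset.range k, single z 1 ^ i) * single s r, ?_⟩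
      rw [← mul_assoc, mul_geom_sum, sub_mul, one_mul, single_pow, one_pow, single_mul_single,
        one_mul, ← hg]
  obtain ⟨y, hy⟩ := key x
  exact ⟨y, by rw [← hy, hx, mapDomain_zero, sub_zero]⟩

/-- The augmentation ideal of a finite `p`-group is nil if `p` is nilpotent in the coefficients. -/
theorem isNilpotent_of_augmentation_eq_zero_of_finite {p : ℕ} (hp : p.Prime)
    (hpR : IsNilpotent (p : R)) [Finite G] (hG : IsPGroup p G) {x : MonoidAlgebra R G}
    (hx : augmentation R G x = 0) : IsNilpotent x := by
  induction hn : Nat.card G using Nat.strong_induction_on generalizing G with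
  | _ n ih =>
    subst hn
    have : Fact p.Prime := ⟨hp⟩
    rcases subsingleton_or_nontrivial G with hsub | hnt
    · suffices x = 0 from this ▸ IsNilpotent.zero
      have key : ∀ y : MonoidAlgebra R G, y = single 1 (augmentation R G y) := by
        intro y
        induction y using induction_linear with
        | zero => simp
        | add a b ha hb => rw [map_add, single_add, ← ha, ← hb]
        | single g r => rw [augmentation_single, Subsingleton.elim g 1]
      rw [key x, hx, single_zero]
    · have := hG.center_nontrivial
      obtain ⟨⟨z, hz⟩, hz1⟩ := exists_ne (1 : Subgroup.center G)
      have hz1 : z ≠ 1 := fun h => hz1 (Subtype.ext h)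
      have : (Subgroup.zpowers z).Normal := by
        refine ⟨fun a ha g => ?_⟩
        have hac : a ∈ Subgroup.center G := (Subgroup.zpowers_le.2 hz) ha
        rwa [Subgroup.mem_center_iff.1 hac g, mul_inv_cancel_right]
      have hcard : Nat.card (G ⧸ Subgroup.zpowers z) < Nat.card G := by
        rw [Subgroup.card_eq_card_quotient_mul_card_subgroup (Subgroup.zpowers z)]
        refine lt_mul_of_one_lt_right Nat.card_pos ?_
        rw [Subgroup.one_lt_card_iff_ne_bot]
        exact fun h => hz1 (Subgroup.zpowers_eq_bot.1 h)
      obtain ⟨m, hm⟩ := ih _ hcard (hG.to_quotient _)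
        (x := mapDomainRingHom R (QuotientGroup.mk' (Subgroup.zpowers z)) x)
        ((augmentation_mapDomainRingHom _ x).trans hx) rfl
      rw [← map_pow] at hm
      obtain ⟨y, hy⟩ := exists_eq_mul_of_mapDomain_mk_eq_zero hz hm
      refine IsNilpotent.of_pow (m := m) ?_
      have hcomm : Commute (single z 1 - 1 : MonoidAlgebra R G) y := by
        refine Commute.sub_left ?_ (Commute.one_left y)
        exact single_commute (fun g => (Subgroup.mem_center_iff.1 hz g).symm)
          (fun r => Commute.one_left r) y
      rw [hy]
      refine hcomm.isNilpotent_mul_right ?_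
      obtain ⟨k, hk⟩ := hG z
      refine isNilpotent_sub_one_of_pow_prime_pow_eq_one hp ?_ (n := k) ?_
      · simpa using hpR.map (singleOneRingHom (R := R) (M := G))
      · rw [single_pow, hk, one_pow, one_def]

/-- The augmentation ideal of a locally finite `p`-group is nil if `p` is nilpotent in the
coefficients. -/
theorem isNilpotent_of_augmentation_eq_zero {p : ℕ} (hp : p.Prime)
    (hpR : IsNilpotent (p : R)) (hLF : ∀ H : Subgroup G, H.FG → Finite H) (hG : IsPGroup p G)
    {x : MonoidAlgebra R G} (hx : augmentation R G x = 0) : IsNilpotent x := by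
  let K := Subgroup.closure (x.coeff.support : Set G)
  have : Finite K := hLF K ⟨x.coeff.support, rfl⟩
  have hsupp : (x.coeff.support : Set G) ⊆ Set.range K.subtype := fun g hg =>
    ⟨⟨g, Subgroup.subset_closure hg⟩, rfl⟩
  have hx' : mapDomainRingHom R K.subtype (comapDomain K.subtype K.subtype_injective x) = x :=
    mapDomain_comapDomain hsupp _
  rw [← hx']
  refine IsNilpotent.map (isNilpotent_of_augmentation_eq_zero_of_finite hp hpR
    (hG.to_subgroup K) ?_) _
  rw [← augmentation_mapDomainRingHom K.subtype, hx', hx]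

end MonoidAlgebra

theorem monoidAlgebra_isUWNC {R : Type*} [Ring R] {G : Type*} [Group G] (p : ℕ)
    (hp : p.Prime) (hR : IsUWNC R) (hpR : IsNilpotent (p : R))
    (hLF : ∀ H : Subgroup G, H.FG → Finite H) (hpG : IsPGroup p G) :
    IsUWNC (MonoidAlgebra R G) := by
  intro u
  obtain ⟨e, n, he, hn, h⟩ := hR (Units.map (MonoidAlgebra.augmentation R G).toMonoidHom u)
  have lift_nil : ∀ x : MonoidAlgebra R G, IsNilpotent (MonoidAlgebra.augmentation R G x) →
      IsNilpotent x := by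
    rintro x ⟨m, hm⟩
    rw [← map_pow] at hm
    exact IsNilpotent.of_pow (MonoidAlgebra.isNilpotent_of_augmentation_eq_zero hp hpR hLF hpG hm)
  have hE : IsIdempotentElem (MonoidAlgebra.single (1 : G) e) := by
    rw [IsIdempotentElem, MonoidAlgebra.single_mul_single, one_mul, he.eq]
  rcases h with h | h <;> replace h : MonoidAlgebra.augmentation R G u = _ := h
  · refine ⟨MonoidAlgebra.single 1 e, (u : MonoidAlgebra R G) - MonoidAlgebra.single 1 e, hE,
      lift_nil _ ?_, .inl ?_⟩
    · simpa [h] using hn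
    · abel
  · refine ⟨MonoidAlgebra.single 1 e, (u : MonoidAlgebra R G) + MonoidAlgebra.single 1 e, hE,
      lift_nil _ ?_, .inr ?_⟩
    · simpa [h] using hn
    · abel
end
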